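/- Let S be a Cu-semigroup in which every element is weakly (2,ω)-divisible. Then for every k ≥ 2, every element of S is weakly (k,ω)-divisible. -/

import Mathlib

variable {S : Type*} [AddCommMonoid S] [PartialOrder S]

/-- The (sequential) way-below relation: `x ≪ y` if for every increasing sequence whose
supremum dominates `y`, some member of the sequence dominates `x`. -/
def WayBelow (x y : S) : Prop :=
  ∀ f : ℕ → S, Monotone f → ∀ s : S, IsLUB (Set.range f) s → y ≤ s → ∃ n, x ≤ f n

/-- A Cu-semigroup (abstract Cuntz semigroup): a positively ordered commutative monoid
satisfying the axioms (O1)-(O4). -/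
structure IsCuSemigroup (S : Type*) [AddCommMonoid S] [PartialOrder S] : Prop where
  zero_le : ∀ x : S, 0 ≤ x
  add_le_add : ∀ {a b c d : S}, a ≤ b → c ≤ d → a + c ≤ b + d
  O1 : ∀ f : ℕ → S, Monotone f → ∃ s : S, IsLUB (Set.range f) s
  O2 : ∀ x : S, ∃ f : ℕ → S, (∀ n, WayBelow (f n) (f (n + 1))) ∧ IsLUB (Set.range f) x
  O3 : ∀ {x' x y' y : S}, WayBelow x' x → WayBelow y' y → WayBelow (x' + y') (x + y)
  O4 : ∀ f g : ℕ → S, Monotone f → Monotone g → ∀ s t : S, IsLUB (Set.range f) s →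
    IsLUB (Set.range g) t → IsLUB (Set.range fun n => f n + g n) (s + t)

/-- Axiom (O5) for Cu-semigroups. -/
def AxiomO5 (S : Type*) [AddCommMonoid S] [PartialOrder S] : Prop :=
  ∀ x' x y' y z : S, x + y ≤ z → WayBelow x' x → WayBelow y' y →
    ∃ c : S, x' + c ≤ z ∧ z ≤ x + c ∧ WayBelow y' c

/-- Axiom (O6) for Cu-semigroups. -/
def AxiomO6 (S : Type*) [AddCommMonoid S] [PartialOrder S] : Prop :=
  ∀ x' x y z : S, WayBelow x' x → x ≤ y + z →
    ∃ e f : S, x' ≤ e + f ∧ e ≤ x ∧ e ≤ y ∧ f ≤ x ∧ f ≤ z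

/-- Axiom (O8) for Cu-semigroups. -/
def AxiomO8 (S : Type*) [AddCommMonoid S] [PartialOrder S] : Prop :=
  ∀ x' x y' y z w : S, 2 • w = w → WayBelow (x + y) (z + w) → WayBelow x' x → WayBelow y' y →
    ∃ z₁ z₂ : S, WayBelow (z₁ + z₂) z ∧ WayBelow x' (z₁ + w) ∧ WayBelow y' (z₂ + w) ∧
      WayBelow z₁ (x + w) ∧ WayBelow z₂ (y + w)

/-- A Cu-semigroup is weakly cancellative if `x + z ≪ y + z` implies `x ≪ y`. -/
def WeaklyCancellative (S : Type*) [AddCommMonoid S] [PartialOrder S] : Prop :=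
  ∀ x y z : S, WayBelow (x + z) (y + z) → WayBelow x y

/-- An element `x` is weakly `(k,ω)`-divisible. -/
def IsWeaklyDivisible (k : ℕ) (x : S) : Prop :=
  ∀ x' : S, WayBelow x' x → ∃ (n : ℕ) (y : Fin n → S),
    (∀ j, k • y j ≤ x) ∧ x' ≤ ∑ j, y j

/-- An element `x` is `(k,ω)`-divisible. -/
def IsDivisible (k : ℕ) (x : S) : Prop :=
  ∀ x' : S, WayBelow x' x → ∃ (n : ℕ) (y : S), k • y ≤ x ∧ x' ≤ n • y

/-- The interval axiom for Cu-semigroups. -/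
def IntervalAxiom (S : Type*) [AddCommMonoid S] [PartialOrder S] : Prop :=
  ∀ x' x y u v : S, WayBelow x' x → WayBelow x (y + u) → WayBelow x (y + v) →
    ∃ w : S, WayBelow x' (y + w) ∧ WayBelow w u ∧ WayBelow w v

/-- The Riesz Interpolation Property. -/
def RieszInterpolation (S : Type*) [AddCommMonoid S] [PartialOrder S] : Prop :=
  ∀ x₁ x₂ y₁ y₂ : S, x₁ ≤ y₁ → x₁ ≤ y₂ → x₂ ≤ y₁ → x₂ ≤ y₂ →
    ∃ z : S, x₁ ≤ z ∧ x₂ ≤ z ∧ z ≤ y₁ ∧ z ≤ y₂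

/-- A Cu-semigroup is countably based if there is a countable subset such that every
element is the supremum of an increasing sequence from that subset. -/
def CountablyBased (S : Type*) [AddCommMonoid S] [PartialOrder S] : Prop :=
  ∃ B : Set S, B.Countable ∧ ∀ x : S, ∃ f : ℕ → S,
    Monotone f ∧ (∀ n, f n ∈ B) ∧ IsLUB (Set.range f) x

/-- A Cu-semigroup is inf-semilattice ordered if finite infima exist and addition
distributes over them. -/
def InfSemilatticeOrdered (S : Type*) [AddCommMonoid S] [PartialOrder S] : Prop :=
  (∀ x y : S, ∃ m : S, IsGLB {x, y} m) ∧
    ∀ x y z m : S, IsGLB {x, y} m → IsGLB {x + z, y + z} (m + z)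

theorem WayBelow.le {P : Type*} [PartialOrder P] {x y : P} (h : WayBelow x y) : x ≤ y := by
  obtain ⟨_, hn⟩ := h (fun _ => y) monotone_const y (by simp) le_rfl
  exact hn

theorem WayBelow.trans_le {P : Type*} [PartialOrder P] {x y z : P} (h : WayBelow x y)
    (hyz : y ≤ z) : WayBelow x z :=
  fun f hf s hs hz => h f hf s hs (hyz.trans hz)

theorem LE.le.trans_wayBelow {P : Type*} [PartialOrder P] {x y z : P} (hxy : x ≤ y)
    (h : WayBelow y z) : WayBelow x z :=
  fun f hf s hs hz => (h f hf s hs hz).imp fun _ hn => hxy.trans hn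

theorem monotone_of_wayBelow_succ {P : Type*} [PartialOrder P] {f : ℕ → P}
    (hf : ∀ n, WayBelow (f n) (f (n + 1))) : Monotone f :=
  monotone_nat_of_le_succ fun n => (hf n).le

namespace IsCuSemigroup

theorem isOrderedAddMonoid (hS : IsCuSemigroup S) : IsOrderedAddMonoid S where
  add_le_add_left _ _ h _ := hS.add_le_add h le_rfl

theorem exists_wayBelow_wayBelow (hS : IsCuSemigroup S) {x' x : S} (h : WayBelow x' x) :
    ∃ x'', WayBelow x' x'' ∧ WayBelow x'' x := by
  obtain ⟨f, hf, hx⟩ := hS.O2 x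
  obtain ⟨n, hn⟩ := h f (monotone_of_wayBelow_succ hf) x hx le_rfl
  exact ⟨f (n + 1), hn.trans_wayBelow (hf n),
    (hf (n + 1)).trans_le (hx.1 ⟨n + 2, rfl⟩)⟩

theorem isLUB_range_finset_sum (hS : IsCuSemigroup S) {ι : Type*} (s : Finset ι)
    (f : ι → ℕ → S) (y : ι → S) (hf : ∀ i, Monotone (f i))
    (hy : ∀ i, IsLUB (Set.range (f i)) (y i)) :
    IsLUB (Set.range fun n => ∑ i ∈ s, f i n) (∑ i ∈ s, y i) := by
  classical
  have := hS.isOrderedAddMonoid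
  induction s using Finset.induction_on with
  | empty => simp
  | insert a s ha ih =>
    simp only [Finset.sum_insert ha]
    exact hS.O4 (f a) (fun n => ∑ i ∈ s, f i n) (hf a)
      (fun m n hmn => Finset.sum_le_sum fun i _ => hf i hmn) _ _ (hy a) ih

theorem exists_wayBelow_le_sum (hS : IsCuSemigroup S) {ι : Type*} [Fintype ι] {x : S}
    {y : ι → S} (h : WayBelow x (∑ i, y i)) :
    ∃ y' : ι → S, (∀ i, WayBelow (y' i) (y i)) ∧ x ≤ ∑ i, y' i := by
  have := hS.isOrderedAddMonoid
  choose f hf hy using fun i => hS.O2 (y i)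
  have hmono i := monotone_of_wayBelow_succ (hf i)
  obtain ⟨n, hn⟩ := h (fun n => ∑ i, f i n)
    (fun m n hmn => Finset.sum_le_sum fun i _ => hmono i hmn) _
    (hS.isLUB_range_finset_sum Finset.univ f y hmono hy) le_rfl
  exact ⟨fun i => f i n, fun i => (hf i n).trans_le ((hy i).1 ⟨n + 1, rfl⟩), hn⟩

theorem isWeaklyDivisible_mul (hS : IsCuSemigroup S) {k l : ℕ} {x : S}
    (hx : IsWeaklyDivisible k x) (hl : ∀ y : S, IsWeaklyDivisible l y) :
    IsWeaklyDivisible (k * l) x := by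
  have := hS.isOrderedAddMonoid
  intro x' hx'
  obtain ⟨x'', h₁, h₂⟩ := hS.exists_wayBelow_wayBelow hx'
  obtain ⟨n, y, hy, hxy⟩ := hx x'' h₂
  obtain ⟨y', hy', hxy'⟩ := hS.exists_wayBelow_le_sum (h₁.trans_le hxy)
  choose m z hz hyz using fun j => hl (y j) (y' j) (hy' j)
  let e := (Fintype.equivFin (Σ j, Fin (m j))).symm
  refine ⟨_, fun i => z (e i).1 (e i).2, fun i => ?_, ?_⟩
  · rw [mul_comm, mul_nsmul]
    exact (nsmul_le_nsmul_right (hz _ _) k).trans (hy _)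
  · rw [e.sum_comp fun p => z p.1 p.2, Fintype.sum_sigma]
    exact hxy'.trans (Finset.sum_le_sum fun j _ => hyz j)

theorem isWeaklyDivisible_mono (hS : IsCuSemigroup S) {k l : ℕ} (hkl : k ≤ l) {x : S}
    (hx : IsWeaklyDivisible l x) : IsWeaklyDivisible k x := by
  have := hS.isOrderedAddMonoid
  intro x' hx'
  obtain ⟨n, y, hy, hxy⟩ := hx x' hx'
  exact ⟨n, y, fun j => (nsmul_le_nsmul_left (hS.zero_le _) hkl).trans (hy j), hxy⟩

theorem isWeaklyDivisible_pow (hS : IsCuSemigroup S) {k : ℕ}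
    (hk : ∀ x : S, IsWeaklyDivisible k x) (m : ℕ) (x : S) :
    IsWeaklyDivisible (k ^ m) x := by
  induction m with
  | zero => exact fun x' hx' => ⟨1, fun _ => x, by simp, by simpa using hx'.le⟩
  | succ m ih => exact hS.isWeaklyDivisible_mul ih hk

end IsCuSemigroup

theorem weaklyDivisible_of_two (S : Type*) [AddCommMonoid S] [PartialOrder S]
    (hS : IsCuSemigroup S) (h2 : ∀ x : S, IsWeaklyDivisible 2 x) :
    ∀ k : ℕ, 2 ≤ k → ∀ x : S, IsWeaklyDivisible k x := by
  intro k _ x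
  exact hS.isWeaklyDivisible_mono Nat.lt_two_pow_self.le (hS.isWeaklyDivisible_pow h2 k x)
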